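/- Let D be a directed set and suppose ▽ has the property that no ▽-sequence is strictly ascending (every sequence d_{i+1} = d_i ▽ b_i is eventually stationary) and △ has the property that no △-sequence is strictly descending. Consider a finite system x_i = f_i (i = 1..n) of monotone equations. Then structured round-robin iteration with the combined operator ⊟ (narrowing when the new value is ⊑ the old, widening otherwise), started from any initial assignment, terminates and returns a post-solution ρ with f_i ρ ⊑ ρ x_i for all i. -/

import Mathlib

open Classical in
noncomputable def combine {D : Type*} [Preorder D] (w nar : D → D → D) (a b : D) : D :=
  if b ≤ a then nar a b else w a b

open Classical in
noncomputable def srr {D : Type*} (box : D → D → D) (f : ℕ → (ℕ → D) → D) :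
    ℕ → ℕ → (ℕ → D) → Option ((ℕ → D) × ℕ)
  | 0, _, _ => none
  | _fuel+1, 0, ρ => some (ρ, 0)
  | fuel+1, i+1, ρ =>
    match srr box f fuel i ρ with
    | none => none
    | some (ρ₁, c₁) =>
      let newv := box (ρ₁ i) (f i ρ₁)
      if newv = ρ₁ i then some (ρ₁, c₁ + 1)
      else
        match srr box f fuel (i+1) (Function.update ρ₁ i newv) with
        | none => none
        | some (ρ₂, c₂) => some (ρ₂, c₁ + 1 + c₂)

/-- Big-step semantics of structured round-robin iteration on the first `i` unknowns. -/
inductive Solves {D : Type*} (box : D → D → D) (f : ℕ → (ℕ → D) → D) :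
    ℕ → (ℕ → D) → (ℕ → D) → Prop
  | zero (ρ : ℕ → D) : Solves box f 0 ρ ρ
  | stable {i : ℕ} {ρ ρ₁ : ℕ → D} (h : Solves box f i ρ ρ₁)
      (heq : box (ρ₁ i) (f i ρ₁) = ρ₁ i) : Solves box f (i + 1) ρ ρ₁
  | step {i : ℕ} {ρ ρ₁ ρ₂ : ℕ → D} (h : Solves box f i ρ ρ₁)
      (hne : box (ρ₁ i) (f i ρ₁) ≠ ρ₁ i)
      (h' : Solves box f (i + 1) (Function.update ρ₁ i (box (ρ₁ i) (f i ρ₁))) ρ₂) :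
      Solves box f (i + 1) ρ ρ₂

/-- Every big-step derivation is realised by `srr` once there is enough fuel. -/
theorem Solves.exists_srr_eq {D : Type*} {box : D → D → D} {f : ℕ → (ℕ → D) → D} {i : ℕ}
    {ρ ρ' : ℕ → D} (h : Solves box f i ρ ρ') :
    ∃ N c, ∀ fuel, N ≤ fuel → srr box f fuel i ρ = some (ρ', c) := by
  induction h with
  | zero ρ =>
    refine ⟨1, 0, fun fuel hf => ?_⟩
    obtain ⟨k, rfl⟩ := Nat.exists_eq_add_of_le' hf
    simp [srr]
  | stable h heq ih =>
    obtain ⟨N, c, ih⟩ := ih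
    refine ⟨N + 1, c + 1, fun fuel hf => ?_⟩
    obtain ⟨k, rfl⟩ := Nat.exists_eq_add_of_le' hf
    simp [srr, ih (k + N) (by omega), heq]
  | step h hne h' ih ih' =>
    obtain ⟨N, c, ih⟩ := ih
    obtain ⟨N', c', ih'⟩ := ih'
    refine ⟨max N N' + 1, c + 1 + c', fun fuel hf => ?_⟩
    obtain ⟨k, rfl⟩ := Nat.exists_eq_add_of_le' hf
    simp [srr, ih (k + max N N') (by omega), ih' (k + max N N') (by omega), hne]

/-- The iteration on the first `i` unknowns leaves the others unchanged. -/
theorem Solves.apply_eq_of_le {D : Type*} {box : D → D → D} {f : ℕ → (ℕ → D) → D} {i : ℕ}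
    {ρ ρ' : ℕ → D} (h : Solves box f i ρ ρ') {j : ℕ} (hj : i ≤ j) : ρ' j = ρ j := by
  induction h with
  | zero ρ => rfl
  | stable h heq ih => exact ih (by omega)
  | step h hne h' ih ih' =>
    rw [ih' hj, Function.update_of_ne (by omega), ih (by omega)]

/-- `ρ` is a post-solution of the first `m` equations. -/
def IsPostSolution {D : Type*} [Preorder D] (f : ℕ → (ℕ → D) → D) (m : ℕ) (ρ : ℕ → D) : Prop :=
  ∀ j, j < m → f j ρ ≤ ρ j

theorem le_of_combine_eq {D : Type*} [Preorder D] {w nar : D → D → D}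
    (hw2 : ∀ a b, b ≤ w a b) {a b : D} (h : combine w nar a b = a) : b ≤ a := by
  by_contra hb
  rw [combine, if_neg hb] at h
  exact hb (h ▸ hw2 a b)

theorem Solves.isPostSolution {D : Type*} [Preorder D] {w nar : D → D → D}
    {f : ℕ → (ℕ → D) → D} (hw2 : ∀ a b, b ≤ w a b) {i : ℕ} {ρ ρ' : ℕ → D}
    (h : Solves (combine w nar) f i ρ ρ') : IsPostSolution f i ρ' := by
  induction h with
  | zero ρ => exact fun j hj => absurd hj (Nat.not_lt_zero j)
  | stable h heq ih =>
    intro j hj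
    rcases Nat.lt_succ_iff_lt_or_eq.mp hj with hj | rfl
    · exact ih j hj
    · exact le_of_combine_eq hw2 heq
  | step h hne h' ih ih' => exact ih'

/-- Updating an unknown of a post-solution yields a post-solution again. -/
theorem IsPostSolution.update {D : Type*} [Preorder D] {w nar : D → D → D}
    {f : ℕ → (ℕ → D) → D} (hn : ∀ a b, b ≤ a → b ≤ nar a b ∧ nar a b ≤ a)
    (hmono : ∀ i, Monotone (f i)) {m i : ℕ} (hi : i < m) {ρ : ℕ → D}
    (h : IsPostSolution f m ρ) :
    IsPostSolution f m (Function.update ρ i (combine w nar (ρ i) (f i ρ))) := by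
  have hc : combine w nar (ρ i) (f i ρ) = nar (ρ i) (f i ρ) := if_pos (h i hi)
  obtain ⟨h₁, h₂⟩ := hn _ _ (h i hi)
  rw [hc]
  have hle : Function.update ρ i (nar (ρ i) (f i ρ)) ≤ ρ := update_le_self_iff.mpr h₂
  refine fun j hj => (hmono j hle).trans ?_
  rcases eq_or_ne j i with rfl | hji
  · simpa using h₁
  · simpa [hji] using h j hj

/-- Started from a post-solution, the iteration only passes through post-solutions. -/
theorem Solves.isPostSolution_of_isPostSolution {D : Type*} [Preorder D] {w nar : D → D → D}
    {f : ℕ → (ℕ → D) → D} (hn : ∀ a b, b ≤ a → b ≤ nar a b ∧ nar a b ≤ a)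
    (hmono : ∀ i, Monotone (f i)) {m i : ℕ} (hi : i ≤ m) {ρ ρ' : ℕ → D}
    (h : Solves (combine w nar) f i ρ ρ') (hρ : IsPostSolution f m ρ) :
    IsPostSolution f m ρ' := by
  induction h with
  | zero ρ => exact hρ
  | stable h heq ih => exact ih (by omega) hρ
  | step h hne h' ih ih' =>
    exact ih' hi ((ih (by omega) hρ).update hn hmono (by omega))

/-- Structured round-robin iteration with the combined operator terminates. -/
theorem exists_solves {D : Type*} [Preorder D] {w nar : D → D → D}
    (hw2 : ∀ a b, b ≤ w a b)
    (hn : ∀ a b, b ≤ a → b ≤ nar a b ∧ nar a b ≤ a)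
    (hwterm : ∀ d b : ℕ → D, (∀ i, d (i+1) = w (d i) (b i)) →
      ∃ N, ∀ m, N ≤ m → d m = d N)
    (hnterm : ∀ d b : ℕ → D, (∀ i, b i ≤ d i ∧ d (i+1) = nar (d i) (b i)) →
      ∃ N, ∀ m, N ≤ m → d m = d N)
    {f : ℕ → (ℕ → D) → D} (hmono : ∀ i, Monotone (f i)) (n : ℕ) (ρ : ℕ → D) :
    ∃ ρ', Solves (combine w nar) f n ρ ρ' := by
  induction n generalizing ρ with
  | zero => exact ⟨ρ, .zero ρ⟩
  | succ i ih =>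
    choose S hS using ih
    by_contra hρ
    let next : (ℕ → D) → ℕ → D := fun σ =>
      Function.update (S σ) i (combine w nar (S σ i) (f i (S σ)))
    let r : ℕ → ℕ → D := fun k => next^[k] ρ
    have hr : ∀ k, r (k + 1) = next (r k) := fun k => Function.iterate_succ_apply' next k ρ
    have hdiv : ∀ k, ¬ ∃ ρ', Solves (combine w nar) f (i + 1) (r k) ρ' := by
      intro k
      induction k with
      | zero => exact hρ
      | succ k ihk =>
        rintro ⟨ρ', h⟩
        by_cases heq : combine w nar (S (r k) i) (f i (S (r k))) = S (r k) i
        · exact ihk ⟨_, .stable (hS _) heq⟩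
        · rw [hr] at h
          exact ihk ⟨ρ', .step (hS _) heq h⟩
    let d : ℕ → D := fun k => S (r k) i
    let b : ℕ → D := fun k => f i (S (r k))
    have hd : ∀ k, d (k + 1) = combine w nar (d k) (b k) := by
      intro k
      change S (r (k + 1)) i = _
      rw [(hS _).apply_eq_of_le le_rfl, hr]
      exact Function.update_self ..
    have hne : ∀ k, d (k + 1) ≠ d k := fun k heq =>
      hdiv k ⟨_, .stable (hS _) ((hd k).symm.trans heq)⟩
    by_cases hnar : ∃ k, b k ≤ d k
    · obtain ⟨k, hk⟩ := hnar
      have hpost : ∀ l, IsPostSolution f (i + 1) (S (r (k + l))) := by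
        intro l
        induction l with
        | zero =>
          intro j hj
          rcases Nat.lt_succ_iff_lt_or_eq.mp hj with hj | rfl
          · exact (hS _).isPostSolution hw2 j hj
          · exact hk
        | succ l ihl =>
          refine (hS _).isPostSolution_of_isPostSolution hn hmono (Nat.le_succ i) ?_
          rw [← add_assoc, hr]
          exact ihl.update hn hmono (Nat.lt_succ_self i)
      have hb : ∀ l, b (k + l) ≤ d (k + l) := fun l => hpost l i (Nat.lt_succ_self i)
      obtain ⟨N, hN⟩ := hnterm (fun l => d (k + l)) (fun l => b (k + l))
        fun l => ⟨hb l, (hd (k + l)).trans (if_pos (hb l))⟩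
      exact hne (k + N) (hN (N + 1) (Nat.le_succ N))
    · push Not at hnar
      obtain ⟨N, hN⟩ := hwterm d b fun k => (hd k).trans (if_neg (hnar k))
      exact hne N (hN (N + 1) (Nat.le_succ N))

theorem stmt8 {D : Type*} [PartialOrder D]
    (hdir : ∀ a b : D, ∃ c, a ≤ c ∧ b ≤ c)
    (w nar : D → D → D)
    (hw1 : ∀ a b, a ≤ w a b) (hw2 : ∀ a b, b ≤ w a b)
    (hn : ∀ a b, b ≤ a → b ≤ nar a b ∧ nar a b ≤ a)
    (hwterm : ∀ d b : ℕ → D, (∀ i, d (i+1) = w (d i) (b i)) →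
      ∃ N, ∀ m, N ≤ m → d m = d N)
    (hnterm : ∀ d b : ℕ → D, (∀ i, b i ≤ d i ∧ d (i+1) = nar (d i) (b i)) →
      ∃ N, ∀ m, N ≤ m → d m = d N)
    (n : ℕ) (f : ℕ → (ℕ → D) → D) (hmono : ∀ i, Monotone (f i)) (ρ0 : ℕ → D) :
    ∃ fuel ρ' c, srr (combine w nar) f fuel n ρ0 = some (ρ', c) ∧
      ∀ i, i < n → f i ρ' ≤ ρ' i := by
  obtain ⟨ρ', h⟩ := exists_solves hw2 hn hwterm hnterm hmono n ρ0
  obtain ⟨N, c, hN⟩ := h.exists_srr_eq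
  exact ⟨N, ρ', c, hN N le_rfl, h.isPostSolution hw2⟩
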